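/- For all positive integers P and Q: F(P/Q) − F(1) = ∑_{α: α^P = 1} ( ∑_{β: β^Q = 1, β ≠ 1} f(α,β) − ∑_{β: β^P = 1, β ≠ 1} f(α,β) ), where for roots of unity α and β with β ≠ 1, f(α,β) = ∫₀¹ log(1 − αt)/(t·(1 − βt)) dt, with log the principal branch of the complex logarithm. (This expresses F(P/Q) − F(1) as a rational linear combination of dilogarithms at arguments in the cyclotomic field ℚ(e^{2πiP/Q}, e^{2πiQ/P}).) -/

import Mathlib

open Real

/-- The digamma function ψ = Γ′/Γ. -/
noncomputable def digamma (x : ℝ) : ℝ := deriv Real.Gamma x / Real.Gamma x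

/-- The Herglotz function F(x) = ∑_{n≥1} (ψ(nx) − log(nx))/n. -/
noncomputable def herglotzF (x : ℝ) : ℝ :=
  ∑' n : ℕ, (digamma (((n : ℝ) + 1) * x) - Real.log (((n : ℝ) + 1) * x)) / ((n : ℝ) + 1)

/-- The root of unity e^{2πik/m}. -/
noncomputable def rootOfUnity (k m : ℕ) : ℂ :=
  Complex.exp (2 * (Real.pi : ℂ) * Complex.I * k / m)

/-- f(α,β) = ∫₀¹ log(1−αt)/(t(1−βt)) dt, with the principal branch of the logarithm. -/
noncomputable def fInt (α β : ℂ) : ℂ :=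
  ∫ t in (0:ℝ)..1, Complex.log (1 - α * (t : ℂ)) / ((t : ℂ) * (1 - β * (t : ℂ)))

lemma rootOfUnity_eq_pow (k m : ℕ) : rootOfUnity k m = rootOfUnity 1 m ^ k := by
  rw [rootOfUnity, rootOfUnity, ← Complex.exp_nat_mul]
  congr 1
  push_cast
  ring

lemma isPrimitiveRoot_rootOfUnity_one {m : ℕ} (hm : 0 < m) :
    IsPrimitiveRoot (rootOfUnity 1 m) m := by
  simpa [rootOfUnity] using Complex.isPrimitiveRoot_exp m hm.ne'

lemma norm_rootOfUnity (k m : ℕ) : ‖rootOfUnity k m‖ = 1 := by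
  have : rootOfUnity k m = Complex.exp (((2 * Real.pi * k / m : ℝ) : ℂ) * Complex.I) := by
    rw [rootOfUnity]
    congr 1
    push_cast
    ring
  rw [this, Complex.norm_exp_ofReal_mul_I]

lemma rootOfUnity_pow_self (k : ℕ) {m : ℕ} (hm : 0 < m) : rootOfUnity k m ^ m = 1 := by
  rw [rootOfUnity_eq_pow, pow_right_comm, (isPrimitiveRoot_rootOfUnity_one hm).pow_eq_one, one_pow]

lemma rootOfUnity_ne_one {j m : ℕ} (hj : j ∈ Finset.Ico 1 m) : rootOfUnity j m ≠ 1 := by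
  obtain ⟨h1, h2⟩ := Finset.mem_Ico.mp hj
  rw [rootOfUnity_eq_pow]
  exact (isPrimitiveRoot_rootOfUnity_one (by lia)).pow_ne_one_of_pos_of_lt (by lia) h2

lemma sum_rootOfUnity_pow {m : ℕ} (hm : 0 < m) (n : ℕ) :
    ∑ k ∈ Finset.range m, rootOfUnity k m ^ n = if m ∣ n then (m : ℂ) else 0 := by
  have hζ := isPrimitiveRoot_rootOfUnity_one hm
  have hpow (k : ℕ) : rootOfUnity k m ^ n = (rootOfUnity 1 m ^ n) ^ k := by
    rw [rootOfUnity_eq_pow, pow_right_comm]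
  rw [Finset.sum_congr rfl fun k _ ↦ hpow k]
  split_ifs with h
  · simp [(hζ.pow_eq_one_iff_dvd n).mpr h]
  · have hne : rootOfUnity 1 m ^ n ≠ 1 := fun h1 ↦ h ((hζ.pow_eq_one_iff_dvd n).mp h1)
    rw [geom_sum_eq hne, pow_right_comm, hζ.pow_eq_one]
    simp

lemma sum_Ico_rootOfUnity_pow {m : ℕ} (hm : 0 < m) (n : ℕ) :
    ∑ k ∈ Finset.Ico 1 m, rootOfUnity k m ^ n = (if m ∣ n then (m : ℂ) else 0) - 1 := by
  rw [← sum_rootOfUnity_pow hm, Finset.range_eq_Ico, Finset.sum_eq_sum_Ico_succ_bot hm]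
  simp [rootOfUnity]

lemma one_sub_mul_ne_zero {β : ℂ} (hβ : ‖β‖ = 1) (hβ1 : β ≠ 1) {t : ℝ} (ht : 0 ≤ t) :
    1 - β * (t : ℂ) ≠ 0 := by
  intro h
  have h1 : β * (t : ℂ) = 1 := (sub_eq_zero.mp h).symm
  have h2 := congrArg norm h1
  rw [norm_mul, hβ, Complex.norm_real, Real.norm_of_nonneg ht, one_mul, norm_one] at h2
  exact hβ1 (by simpa [h2] using h1)

/-- The moment `∫₀¹ tⁿ / (1 - βt) dt`. -/
noncomputable def geomMoment (β : ℂ) (n : ℕ) : ℂ :=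
  ∫ t in (0:ℝ)..1, (t : ℂ) ^ n / (1 - β * (t : ℂ))

lemma continuousOn_geomMoment_integrand {β : ℂ} (hβ : ‖β‖ = 1) (hβ1 : β ≠ 1) (n : ℕ) :
    ContinuousOn (fun t : ℝ ↦ (t : ℂ) ^ n / (1 - β * (t : ℂ))) (Set.Icc 0 1) :=
  ContinuousOn.div (by fun_prop) (by fun_prop) fun _ ht ↦ one_sub_mul_ne_zero hβ hβ1 ht.1

lemma intervalIntegrable_geomMoment_integrand {β : ℂ} (hβ : ‖β‖ = 1) (hβ1 : β ≠ 1) (n : ℕ) :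
    IntervalIntegrable (fun t : ℝ ↦ (t : ℂ) ^ n / (1 - β * (t : ℂ))) MeasureTheory.volume 0 1 :=
  ContinuousOn.intervalIntegrable_of_Icc zero_le_one (continuousOn_geomMoment_integrand hβ hβ1 n)

lemma exists_integral_norm_le {β : ℂ} (hβ : ‖β‖ = 1) (hβ1 : β ≠ 1) :
    ∃ C : ℝ, ∀ n : ℕ, ∫ t in (0:ℝ)..1, ‖(t : ℂ) ^ n / (1 - β * (t : ℂ))‖ ≤ C / (n + 1) := by
  obtain ⟨C, hC⟩ := isCompact_Icc.exists_bound_of_continuousOn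
    (continuousOn_geomMoment_integrand hβ hβ1 0)
  refine ⟨C, fun n ↦ ?_⟩
  calc ∫ t in (0:ℝ)..1, ‖(t : ℂ) ^ n / (1 - β * (t : ℂ))‖
      ≤ ∫ t in (0:ℝ)..1, C * t ^ n := by
        refine intervalIntegral.integral_mono_on zero_le_one
          (intervalIntegrable_geomMoment_integrand hβ hβ1 n).norm
          (Continuous.intervalIntegrable (by fun_prop) _ _) fun t ht ↦ ?_
        have h := hC t ht
        rw [pow_zero, one_div] at h
        rw [div_eq_mul_inv, norm_mul, norm_pow, Complex.norm_real, Real.norm_of_nonneg ht.1,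
          mul_comm]
        exact mul_le_mul_of_nonneg_right h (pow_nonneg ht.1 n)
    _ = C / (n + 1) := by
        rw [intervalIntegral.integral_const_mul, integral_pow]
        simp [div_eq_mul_inv]

lemma tendsto_geomMoment {β : ℂ} (hβ : ‖β‖ = 1) (hβ1 : β ≠ 1) :
    Filter.Tendsto (geomMoment β) Filter.atTop (nhds 0) := by
  obtain ⟨C, hC⟩ := exists_integral_norm_le hβ hβ1
  refine squeeze_zero_norm (fun n ↦
    (intervalIntegral.norm_integral_le_integral_norm zero_le_one).trans (hC n)) ?_
  exact tendsto_const_div_atTop_nhds_zero_nat C |>.comp (Filter.tendsto_add_atTop_nat 1)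
    |>.congr fun n ↦ by simp

lemma geomMoment_sub_geomMoment_add {β : ℂ} (hβ : ‖β‖ = 1) (hβ1 : β ≠ 1) {m : ℕ}
    (hm : β ^ m = 1) (n : ℕ) :
    geomMoment β n - geomMoment β (n + m) =
      ∑ i ∈ Finset.range m, β ^ i / ((n : ℂ) + i + 1) := by
  rw [geomMoment, geomMoment, ← intervalIntegral.integral_sub
    (intervalIntegrable_geomMoment_integrand hβ hβ1 _)
    (intervalIntegrable_geomMoment_integrand hβ hβ1 _)]
  have h : Set.EqOn
      (fun t : ℝ ↦ (t : ℂ) ^ n / (1 - β * (t : ℂ)) - (t : ℂ) ^ (n + m) / (1 - β * (t : ℂ)))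
      (fun t : ℝ ↦ ∑ i ∈ Finset.range m, β ^ i * (t : ℂ) ^ (n + i)) (Set.uIcc 0 1) := by
    intro t ht
    rw [Set.uIcc_of_le zero_le_one] at ht
    have h0 := one_sub_mul_ne_zero hβ hβ1 ht.1
    have hg := mul_neg_geom_sum (β * (t : ℂ)) m
    rw [mul_pow, hm, one_mul] at hg
    have hs : ∑ i ∈ Finset.range m, β ^ i * (t : ℂ) ^ (n + i) =
        (t : ℂ) ^ n * ∑ i ∈ Finset.range m, (β * (t : ℂ)) ^ i := by
      rw [Finset.mul_sum]
      exact Finset.sum_congr rfl fun i _ ↦ by ring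
    simp only
    rw [hs, ← sub_div, div_eq_iff h0, mul_assoc, mul_comm (∑ i ∈ _, _), hg]
    ring
  rw [intervalIntegral.integral_congr h, intervalIntegral.integral_finsetSum
    fun i _ ↦ Continuous.intervalIntegrable (by fun_prop) _ _]
  refine Finset.sum_congr rfl fun i _ ↦ ?_
  rw [intervalIntegral.integral_const_mul]
  have : ∫ t in (0:ℝ)..1, (t : ℂ) ^ (n + i) = ((∫ t in (0:ℝ)..1, t ^ (n + i) : ℝ) : ℂ) := by
    rw [← intervalIntegral.integral_ofReal]
    simp
  rw [this, integral_pow]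
  simp [div_eq_mul_inv]

lemma hasSum_fInt {α β : ℂ} (hα : ‖α‖ = 1) (hβ : ‖β‖ = 1) (hβ1 : β ≠ 1) :
    HasSum (fun n : ℕ ↦ -(α ^ (n + 1) / ((n : ℂ) + 1)) * geomMoment β n) (fInt α β) := by
  set μ : MeasureTheory.Measure ℝ := MeasureTheory.volume.restrict (Set.Ioc 0 1)
  set F : ℕ → ℝ → ℂ := fun n t ↦
    -(α ^ (n + 1) / ((n : ℂ) + 1)) * ((t : ℂ) ^ n / (1 - β * (t : ℂ))) with hF
  have hint (n : ℕ) : MeasureTheory.Integrable (F n) μ :=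
    (intervalIntegrable_geomMoment_integrand hβ hβ1 n).1.const_mul _
  have hcoef (n : ℕ) : ‖-(α ^ (n + 1) / ((n : ℂ) + 1))‖ = 1 / ((n : ℝ) + 1) := by
    rw [norm_neg, norm_div, norm_pow, hα, one_pow]
    congr 1
    exact_mod_cast Complex.norm_natCast (n + 1)
  obtain ⟨C, hC⟩ := exists_integral_norm_le hβ hβ1
  have hsum : Summable fun n ↦ ∫ t, ‖F n t‖ ∂μ := by
    have hs : Summable fun n : ℕ ↦ C * (1 / ((n : ℝ) + 1) ^ 2) := by
      refine Summable.mul_left _ ?_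
      exact_mod_cast (summable_nat_add_iff 1).mpr
        (Real.summable_one_div_nat_pow.mpr (one_lt_two : 1 < 2))
    refine hs.of_nonneg_of_le (fun n ↦ MeasureTheory.integral_nonneg fun _ ↦ norm_nonneg _)
      fun n ↦ ?_
    simp_rw [hF, norm_mul _ (_ / _), hcoef]
    rw [MeasureTheory.integral_const_mul, ← intervalIntegral.integral_of_le zero_le_one]
    calc _ ≤ 1 / ((n : ℝ) + 1) * (C / (n + 1)) :=
          mul_le_mul_of_nonneg_left (hC n) (by positivity)
      _ = C * (1 / ((n : ℝ) + 1) ^ 2) := by field_simp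
  have hval : fInt α β = ∫ t, ∑' n, F n t ∂μ := by
    rw [fInt, intervalIntegral.integral_of_le zero_le_one,
      MeasureTheory.integral_Ioc_eq_integral_Ioo, MeasureTheory.integral_Ioc_eq_integral_Ioo]
    refine MeasureTheory.setIntegral_congr_fun measurableSet_Ioo fun t ht ↦ ?_
    have ht0 : (t : ℂ) ≠ 0 := by exact_mod_cast ht.1.ne'
    have hn : ‖α * (t : ℂ)‖ < 1 := by
      rw [norm_mul, hα, one_mul, Complex.norm_real, Real.norm_of_nonneg ht.1.le]
      exact ht.2
    have h := (hasSum_nat_add_iff' 1).mpr (Complex.hasSum_taylorSeries_neg_log hn)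
    have h' := h.mul_right (-1 / ((t : ℂ) * (1 - β * (t : ℂ))))
    have h0 := one_sub_mul_ne_zero hβ hβ1 ht.1.le
    refine Eq.trans ?_ (HasSum.tsum_eq (h'.congr_fun ?_)).symm
    · simp
      field_simp
    · intro n
      have : (n : ℂ) + 1 ≠ 0 := by exact_mod_cast n.succ_ne_zero
      simp only [hF]
      push_cast
      field_simp
      ring
  rw [hval]
  refine (MeasureTheory.hasSum_integral_of_summable_integral_norm hint hsum).congr_fun fun n ↦ ?_
  rw [MeasureTheory.integral_const_mul, geomMoment, intervalIntegral.integral_of_le zero_le_one]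

lemma hasDerivAt_log_comp_Gamma {x : ℝ} (hx : 0 < x) :
    HasDerivAt (Real.log ∘ Real.Gamma) (digamma x) x := by
  have hd : DifferentiableAt ℝ Real.Gamma x :=
    Real.differentiableAt_Gamma fun m ↦ by have := m.cast_nonneg (α := ℝ); linarith
  exact hd.hasDerivAt.log (Real.Gamma_pos_of_pos hx).ne'

lemma log_Gamma_add_one {x : ℝ} (hx : 0 < x) :
    Real.log (Real.Gamma (x + 1)) = Real.log x + Real.log (Real.Gamma x) := by
  rw [Real.Gamma_add_one hx.ne', Real.log_mul hx.ne' (Real.Gamma_pos_of_pos hx).ne']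

lemma digamma_add_one {x : ℝ} (hx : 0 < x) : digamma (x + 1) = digamma x + 1 / x := by
  have h1 : HasDerivAt (fun y ↦ (Real.log ∘ Real.Gamma) (y + 1)) (digamma (x + 1)) x :=
    (hasDerivAt_log_comp_Gamma (by linarith)).comp_add_const x 1
  have h2 := (Real.hasDerivAt_log hx.ne').add (hasDerivAt_log_comp_Gamma hx)
  have h3 : (fun y ↦ (Real.log ∘ Real.Gamma) (y + 1)) =ᶠ[nhds x]
      Real.log + Real.log ∘ Real.Gamma := by
    filter_upwards [eventually_gt_nhds hx] with y hy using log_Gamma_add_one hy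
  rw [h1.unique (h2.congr_of_eventuallyEq h3)]
  ring

lemma digamma_add_nat {x : ℝ} (hx : 0 < x) (n : ℕ) :
    digamma (x + n) = digamma x + ∑ i ∈ Finset.range n, 1 / (x + i) := by
  induction n with
  | zero => simp
  | succ n ih =>
    rw [Nat.cast_succ, ← add_assoc, digamma_add_one (by positivity), ih, Finset.sum_range_succ]
    ring

lemma slope_log_comp_Gamma {x : ℝ} (hx : 0 < x) :
    slope (Real.log ∘ Real.Gamma) x (x + 1) = Real.log x := by
  simp [slope_def_field, log_Gamma_add_one hx]

lemma digamma_le_log {x : ℝ} (hx : 0 < x) : digamma x ≤ Real.log x := by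
  rw [← slope_log_comp_Gamma hx]
  exact Real.convexOn_log_Gamma.le_slope_of_hasDerivAt hx (Set.mem_Ioi.mpr (by linarith))
    (by linarith) (hasDerivAt_log_comp_Gamma hx)

lemma log_sub_le_digamma {x : ℝ} (hx : 0 < x) : Real.log x - 1 / x ≤ digamma x := by
  rw [sub_le_iff_le_add, ← digamma_add_one hx, ← slope_log_comp_Gamma hx]
  exact Real.convexOn_log_Gamma.slope_le_of_hasDerivAt hx (Set.mem_Ioi.mpr (by linarith))
    (by linarith) (hasDerivAt_log_comp_Gamma (by linarith))

lemma abs_digamma_sub_log_le {x : ℝ} (hx : 0 < x) : |digamma x - Real.log x| ≤ 1 / x := by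
  have h1 := digamma_le_log hx
  have h2 := log_sub_le_digamma hx
  have h3 : 0 < 1 / x := by positivity
  rw [abs_le]
  constructor <;> linarith

lemma tendsto_digamma_sub_log :
    Filter.Tendsto (fun x ↦ digamma x - Real.log x) Filter.atTop (nhds 0) := by
  refine squeeze_zero_norm' ?_ tendsto_inv_atTop_zero
  filter_upwards [Filter.eventually_gt_atTop 0] with x hx
  simpa using abs_digamma_sub_log_le hx

lemma hasSum_herglotzF {x : ℝ} (hx : 0 < x) :
    HasSum (fun n : ℕ ↦ (digamma (((n : ℝ) + 1) * x) - Real.log (((n : ℝ) + 1) * x)) /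
      ((n : ℝ) + 1)) (herglotzF x) := by
  refine Summable.hasSum (Summable.of_norm_bounded
    (g := fun n : ℕ ↦ 1 / x * (1 / ((n : ℝ) + 1) ^ 2))
    (Summable.mul_left _ ?_) fun n ↦ ?_)
  · exact_mod_cast (summable_nat_add_iff 1).mpr
      (Real.summable_one_div_nat_pow.mpr (one_lt_two : 1 < 2))
  · have hn : 0 < (n : ℝ) + 1 := by positivity
    rw [norm_div, Real.norm_eq_abs, Real.norm_of_nonneg hn.le, div_le_iff₀ hn]
    refine (abs_digamma_sub_log_le (mul_pos hn hx)).trans_eq ?_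
    field_simp

lemma eq_zero_of_add_period_of_tendsto {u : ℕ → ℂ} {m : ℕ} (hm : 0 < m)
    (hu : ∀ n, u (n + m) = u n) (h : Filter.Tendsto u Filter.atTop (nhds 0)) (n : ℕ) :
    u n = 0 := by
  have hper (N : ℕ) : u (n + N * m) = u n := by
    induction N with
    | zero => simp
    | succ N ih => rw [Nat.succ_mul, ← add_assoc, hu, ih]
  have ht : Filter.Tendsto (fun N : ℕ ↦ n + N * m) Filter.atTop Filter.atTop :=
    Filter.tendsto_atTop_mono (fun N ↦ (Nat.le_mul_of_pos_right N hm).trans (Nat.le_add_left _ _))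
      Filter.tendsto_id
  exact tendsto_nhds_unique (tendsto_const_nhds.congr fun N ↦ (hper N).symm) (h.comp ht)

lemma sum_geomMoment {m : ℕ} (hm : 0 < m) (n : ℕ) :
    ∑ j ∈ Finset.Ico 1 m, geomMoment (rootOfUnity j m) n =
      (((digamma ((n : ℝ) + 1) - Real.log ((n : ℝ) + 1)) -
        (digamma (((n : ℝ) + 1) / m) - Real.log (((n : ℝ) + 1) / m)) : ℝ) : ℂ) := by
  have hm' : (0 : ℝ) < m := by exact_mod_cast hm
  set S : ℕ → ℂ := fun n ↦ ∑ j ∈ Finset.Ico 1 m, geomMoment (rootOfUnity j m) n with hS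
  set d : ℕ → ℝ := fun n ↦ (digamma ((n : ℝ) + 1) - Real.log ((n : ℝ) + 1)) -
        (digamma (((n : ℝ) + 1) / m) - Real.log (((n : ℝ) + 1) / m)) with hd
  have hSper (n : ℕ) : S n - S (n + m) =
      ((m / ((n : ℝ) + 1) - ∑ i ∈ Finset.range m, 1 / ((n : ℝ) + 1 + i) : ℝ) : ℂ) := by
    have h1 : S n - S (n + m) = ∑ j ∈ Finset.Ico 1 m, ∑ i ∈ Finset.range m,
        rootOfUnity j m ^ i / ((n : ℂ) + i + 1) := by
      rw [hS, ← Finset.sum_sub_distrib]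
      exact Finset.sum_congr rfl fun j hj ↦ geomMoment_sub_geomMoment_add (norm_rootOfUnity _ _)
        (rootOfUnity_ne_one hj) (rootOfUnity_pow_self _ hm) n
    rw [h1, Finset.sum_comm]
    simp_rw [← Finset.sum_div, sum_Ico_rootOfUnity_pow hm, sub_div]
    rw [Finset.sum_sub_distrib, Finset.sum_eq_single_of_mem 0 (Finset.mem_range.mpr hm)]
    · push_cast
      simp [add_right_comm]
    · intro i hi hi0
      rw [if_neg (Nat.not_dvd_of_pos_of_lt (Nat.pos_of_ne_zero hi0) (Finset.mem_range.mp hi)),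
        zero_div]
  have hdper (n : ℕ) : d n - d (n + m) =
      m / ((n : ℝ) + 1) - ∑ i ∈ Finset.range m, 1 / ((n : ℝ) + 1 + i) := by
    have hn : (0 : ℝ) < (n : ℝ) + 1 := by positivity
    have e1 : ((n + m : ℕ) : ℝ) + 1 = (n : ℝ) + 1 + m := by push_cast; ring
    have e2 : ((n : ℝ) + 1 + m) / m = ((n : ℝ) + 1) / m + 1 := by field_simp
    have e3 : Real.log (((n : ℝ) + 1) / m + 1) = Real.log ((n : ℝ) + 1 + m) - Real.log m := by
      rw [← e2, Real.log_div (by positivity) hm'.ne']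
    simp only [hd]
    rw [e1, e2, e3, digamma_add_nat hn, digamma_add_one (div_pos hn hm'),
      Real.log_div hn.ne' hm'.ne', one_div_div]
    ring
  have hSlim : Filter.Tendsto S Filter.atTop (nhds 0) := by
    simpa using tendsto_finsetSum (Finset.Ico 1 m) fun j hj ↦
      tendsto_geomMoment (norm_rootOfUnity j m) (rootOfUnity_ne_one hj)
  have hcast : Filter.Tendsto (fun n : ℕ ↦ (n : ℝ) + 1) Filter.atTop Filter.atTop :=
    Filter.tendsto_atTop_add_const_right _ _ tendsto_natCast_atTop_atTop
  have hdlim : Filter.Tendsto d Filter.atTop (nhds 0) := by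
    simpa using (tendsto_digamma_sub_log.comp hcast).sub
      (tendsto_digamma_sub_log.comp (hcast.atTop_div_const hm'))
  have hdlim' : Filter.Tendsto (fun n ↦ (d n : ℂ)) Filter.atTop (nhds 0) := by
    exact_mod_cast (Complex.continuous_ofReal.tendsto 0).comp hdlim
  refine sub_eq_zero.mp (eq_zero_of_add_period_of_tendsto (u := fun n ↦ S n - d n) hm
    (fun n ↦ ?_) (by simpa using hSlim.sub hdlim') n)
  have h := hSper n
  rw [← hdper] at h
  push_cast at h
  linear_combination -h

/-- F(P/Q) − F(1) as a sum of the dilogarithmic integrals f(α,β) over P-th roots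
of unity α and nontrivial Q-th (resp. P-th) roots of unity β. -/
theorem herglotzF_rational_value (P Q : ℕ) (hP : 0 < P) (hQ : 0 < Q) :
    ((herglotzF ((P : ℝ) / (Q : ℝ)) - herglotzF 1 : ℝ) : ℂ) =
      ∑ k ∈ Finset.range P,
        ((∑ j ∈ Finset.Ico 1 Q, fInt (rootOfUnity k P) (rootOfUnity j Q))
          - ∑ j ∈ Finset.Ico 1 P, fInt (rootOfUnity k P) (rootOfUnity j P)) := by
  set T : ℕ → ℕ → ℂ := fun m n ↦ ∑ j ∈ Finset.Ico 1 m, geomMoment (rootOfUnity j m) n with hT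
  have hP' : (0 : ℝ) < P := by exact_mod_cast hP
  have hQ' : (0 : ℝ) < Q := by exact_mod_cast hQ
  have hsum : HasSum (fun n : ℕ ↦ ∑ k ∈ Finset.range P,
      -(rootOfUnity k P ^ (n + 1) / ((n : ℂ) + 1)) * (T Q n - T P n))
      (∑ k ∈ Finset.range P,
        ((∑ j ∈ Finset.Ico 1 Q, fInt (rootOfUnity k P) (rootOfUnity j Q))
          - ∑ j ∈ Finset.Ico 1 P, fInt (rootOfUnity k P) (rootOfUnity j P))) := by
    refine hasSum_sum fun k _ ↦ ?_
    simp_rw [hT, mul_sub, Finset.mul_sum]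
    exact (hasSum_sum fun j hj ↦ hasSum_fInt (norm_rootOfUnity _ _) (norm_rootOfUnity _ _)
      (rootOfUnity_ne_one hj)).sub (hasSum_sum fun j hj ↦ hasSum_fInt (norm_rootOfUnity _ _)
        (norm_rootOfUnity _ _) (rootOfUnity_ne_one hj))
  simp_rw [← Finset.sum_mul, Finset.sum_neg_distrib, ← Finset.sum_div,
    sum_rootOfUnity_pow hP] at hsum
  have hidx (n : ℕ) : P * (n + 1) - 1 + 1 = P * (n + 1) :=
    Nat.sub_add_cancel (Nat.mul_pos hP n.succ_pos)
  have hinj : Function.Injective fun n : ℕ ↦ P * (n + 1) - 1 := by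
    intro a b hab
    have h : P * (a + 1) = P * (b + 1) := by
      rw [← hidx a, ← hidx b]
      exact congrArg (· + 1) hab
    exact Nat.succ_injective (Nat.eq_of_mul_eq_mul_left hP h)
  rw [← hinj.hasSum_iff] at hsum
  swap
  · intro n hn
    rw [if_neg]
    · simp
    · rintro ⟨c, hc⟩
      obtain _ | c := c
      · simp at hc
      · exact hn ⟨c, by simp [← hc]⟩
  have hF := (hasSum_herglotzF (div_pos hP' hQ')).sub (hasSum_herglotzF one_pos)
  refine (Complex.hasSum_ofReal.mpr hF).unique (hsum.congr_fun fun n ↦ ?_)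
  have hc : ((P * (n + 1) - 1 : ℕ) : ℝ) + 1 = P * ((n : ℝ) + 1) := by exact_mod_cast hidx n
  have hc' : ((P * (n + 1) - 1 : ℕ) : ℂ) + 1 = P * ((n : ℂ) + 1) := by exact_mod_cast hidx n
  have hPc : (P : ℂ) ≠ 0 := by exact_mod_cast hP.ne'
  have hn : (n : ℂ) + 1 ≠ 0 := by exact_mod_cast n.succ_ne_zero
  have e1 : (P : ℝ) * ((n : ℝ) + 1) / Q = ((n : ℝ) + 1) * (P / Q) := by ring
  have e2 : (P : ℝ) * ((n : ℝ) + 1) / P = ((n : ℝ) + 1) * 1 := by field_simp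
  simp only [Function.comp_apply, hT]
  rw [sum_geomMoment hP, sum_geomMoment hQ, hidx, if_pos (dvd_mul_right _ _), hc, hc', e1, e2]
  push_cast
  field_simp
  ring
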